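/- arXiv:2410.22714 — 2 statements merged into one kernel-verified Lean document; each statement's English description precedes it below -/
import Mathlib

section
/- Let b ∈ ℤ[i] be fourth-power-free with factorization b = i^{s_b}(1+i)^{t_b} p₁^{r₁}⋯p_M^{r_M} q₁²⋯q_N² (s_b, t_b ∈ {0,1,2,3}, r_i ∈ {1,3}, the p_i, q_j distinct primary primes), let d = i^{s_d}(1+i)^{t_d} ∏_{v ∈ V_d} v (s_d, t_d ∈ {0,1}) be a square-free divisor of b, and let p be one of the p_i with p ∤ d. Then d^{(Nm(p)−1)/2} ≡ 1 (mod p) if and only if deg_d(p) + m_p t_d + n_p s_d ≡ 0 (mod 2), where deg_d(p) := Σ_{w ∈ V_d} e(p→w) reduced mod 2 and m_p, n_p ∈ ℤ/2ℤ satisfy p ≡ (−3)^{m_p}(−1+2i)^{n_p} (mod (1+i)⁵). -/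
open IsDedekindDomain

noncomputable section

/-- The element `i` of the Gaussian integers `ℤ[i]`. -/
def ii : GaussianInt := ⟨0, 1⟩

/-- The element `1 + i` of `ℤ[i]`. -/
def tt : GaussianInt := 1 + ii

/-- A Gaussian integer is *primary* if it is `≡ 1 (mod (1+i)³)`. -/
def IsPrimary (α : GaussianInt) : Prop := tt ^ 3 ∣ (α - 1)

/-- A Gaussian integer `b` is *fourth-power-free* if no fourth power of a prime divides it. -/
def FourthPowerFree (b : GaussianInt) : Prop := ∀ p : GaussianInt, Prime p → ¬ p ^ 4 ∣ b

/-- `HasLocalPoint b d π` says that the homogeneous space `C_d : d·w² = d² − 4·b·z⁴` has a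
point in the completion `ℚ(i)_π` of `ℚ(i)` at the prime `π`, i.e. either the affine equation
`d·w² = d² − 4·b·z⁴` has a solution there, or `b/d` is a square there (the two points at
infinity are rational).  This is the meaning of `C_d(ℚ(i)_π) ≠ ∅`. -/
def HasLocalPoint (b d π : GaussianInt) : Prop :=
  ∀ v : HeightOneSpectrum GaussianInt, v.asIdeal = Ideal.span {π} →
    (∃ z w : v.adicCompletion (FractionRing GaussianInt),
        algebraMap GaussianInt _ d * w ^ 2
          = (algebraMap GaussianInt _ d) ^ 2 - 4 * algebraMap GaussianInt _ b * z ^ 4)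
    ∨ (∃ u : v.adicCompletion (FractionRing GaussianInt),
        u ^ 2 * algebraMap GaussianInt _ d = algebraMap GaussianInt _ b)

/-- The natural reduction `ℤ/4ℤ → ℤ/2ℤ`. -/
def c2 : ZMod 4 →+* ZMod 2 := ZMod.castHom (show (2:ℕ) ∣ 4 by norm_num) (ZMod 2)

open NumberTheorySymbols

lemma coords_of_tt_pow_five_dvd {a b : ℤ} {m n : ZMod 2}
    (h : tt ^ 5 ∣ ((⟨a, b⟩ : GaussianInt) - (-3) ^ m.val * (-1 + 2 * ii) ^ n.val)) :
    b % 4 = 2 * n.val ∧ (a - b) % 8 = 1 + 4 * ((m.val + n.val) % 2 : ℕ) := by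
  obtain ⟨⟨u, v⟩, h⟩ := h
  have htt : tt ^ 5 = ⟨-4, -4⟩ := by decide
  have h3 : (-3 : GaussianInt) = ⟨-3, 0⟩ := by decide
  have h12 : (-1 + 2 * ii : GaussianInt) = ⟨-1, 2⟩ := by decide
  rw [htt, h3, h12, Zsqrtd.ext_iff] at h
  have hm : m.val = 0 ∨ m.val = 1 := by have := m.val_lt; omega
  have hn : n.val = 0 ∨ n.val = 1 := by have := n.val_lt; omega
  rcases hm with hm | hm <;> rcases hn with hn | hn <;> rw [hm, hn] at h <;>
    simp [Zsqrtd.re_mul, Zsqrtd.im_mul] at h <;> rw [hm, hn] <;> omega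

lemma sq_add_sq_emod_eight {a b : ℤ} {m n : ℕ} (hb : b % 4 = 2 * n)
    (hab : (a - b) % 8 = 1 + 4 * ((m + n) % 2 : ℕ)) : (a * a + b * b) % 8 = (1 + 4 * n) % 8 := by
  have ha : a % 8 = 1 ∨ a % 8 = 3 ∨ a % 8 = 5 ∨ a % 8 = 7 := by omega
  have hb8 : (b % 8 = 2 * n ∨ b % 8 = 2 * n + 4) := by omega
  have hn : n = 0 ∨ n = 1 := by omega
  rcases hn with rfl | rfl <;> rcases ha with ha | ha | ha | ha <;> rcases hb8 with hb8 | hb8 <;>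
    simp [Int.add_emod, Int.mul_emod, ha, hb8]

lemma gaussian_norm_mk (a b : ℤ) : Zsqrtd.norm (⟨a, b⟩ : GaussianInt) = a * a + b * b := by
  simp [Zsqrtd.norm_def]

/-- A Gaussian prime with odd real part either has rational prime norm, or is rational. -/
lemma norm_prime_or_im_eq_zero {a b : ℤ} (hp : Prime (⟨a, b⟩ : GaussianInt))
    (ha : a % 2 = 1) (hb : b % 2 = 0) :
    (a * a + b * b).natAbs.Prime ∨ (b = 0 ∧ a.natAbs.Prime) := by
  set p : GaussianInt := ⟨a, b⟩ with hpdef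
  have hN : p.norm = a * a + b * b := gaussian_norm_mk a b
  have key : ∀ k : ℕ, p ∣ (k : GaussianInt) → k ≠ 0 →
      ∃ l : ℕ, l.Prime ∧ p ∣ (l : GaussianInt) := by
    intro k
    induction k using Nat.recOnMul with
    | zero => intro _ h; exact absurd rfl h
    | one => intro h _; exact absurd (isUnit_of_dvd_one (by simpa using h)) hp.not_isUnit
    | prime l hl => intro h _; exact ⟨l, hl, h⟩
    | mul x y hx hy =>
      intro h h0
      rw [Nat.cast_mul] at h
      rcases hp.dvd_or_dvd h with h | h
      · exact hx h (left_ne_zero_of_mul h0)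
      · exact hy h (right_ne_zero_of_mul h0)
  have hpos : 0 < p.norm := GaussianInt.norm_pos.2 hp.ne_zero
  obtain ⟨l, hl, u, hu⟩ := key p.norm.natAbs (by
    rw [GaussianInt.natCast_natAbs_norm, Zsqrtd.norm_eq_mul_conj]
    exact dvd_mul_right _ _) (by omega)
  have hnorm : l * l = p.norm.natAbs * u.norm.natAbs := by
    have := congrArg (fun z => (Zsqrtd.norm z).natAbs) hu
    simpa [Zsqrtd.norm_mul, Int.natAbs_mul] using this
  have hdvd : p.norm.natAbs ∣ l ^ 2 := ⟨_, by rw [pow_two]; exact hnorm⟩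
  obtain ⟨e, he, hle⟩ := (Nat.dvd_prime_pow hl).1 hdvd
  have hne1 : p.norm.natAbs ≠ 1 := fun h => hp.not_isUnit (Zsqrtd.norm_eq_one_iff.1 h)
  interval_cases e
  · exact absurd (by simpa using hle) hne1
  · left
    rw [← hN, hle, pow_one]
    exact hl
  · right
    have hu1 : u.norm.natAbs = 1 := by
      rw [hle, pow_two] at hnorm
      have : 0 < l * l := Nat.mul_pos hl.pos hl.pos
      exact Nat.eq_of_mul_eq_mul_left this (by omega)
    have hu1' : u.re * u.re + u.im * u.im = 1 := by
      have h := GaussianInt.abs_natCast_norm u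
      rw [hu1] at h
      have h2 := gaussian_norm_mk u.re u.im
      simp only [Nat.cast_one] at h
      exact (h.trans h2).symm
    have hre := congrArg Zsqrtd.re hu
    have him := congrArg Zsqrtd.im hu
    simp [hpdef, Zsqrtd.re_mul, Zsqrtd.im_mul] at hre him
    have hr1 : u.re ≤ 1 := by nlinarith
    have hr2 : -1 ≤ u.re := by nlinarith
    have hi1 : u.im ≤ 1 := by nlinarith
    have hi2 : -1 ≤ u.im := by nlinarith
    generalize u.re = x at *
    generalize u.im = y at *
    interval_cases x <;> interval_cases y <;> norm_num at hu1' <;> simp at hre him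
    · refine ⟨by omega, ?_⟩
      have : a.natAbs = l := by omega
      rwa [this]
    · omega
    · omega
    · refine ⟨by omega, ?_⟩
      have : a.natAbs = l := by omega
      rwa [this]

lemma jacobiSym_of_sq_add_sq_even {P : ℕ} (hP : P.Prime) {a b : ℤ} {n : ℕ}
    (hPab : (P : ℤ) = a * a + b * b) (hb : b % 4 = 2 * n)
    (hP8 : (P : ℤ) % 8 = (1 + 4 * n) % 8) : J(b | P) = (-1) ^ n := by
  have hn : n = 0 ∨ n = 1 := by omega
  have hP4 : P % 4 = 1 := by omega
  have hPodd : Odd P := Nat.odd_iff.2 (by omega)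
  have hb0 : b ≠ 0 := by
    rintro rfl
    have : IsSquare (P : ℤ) := ⟨a, by simpa using hPab⟩
    exact (Nat.prime_iff_prime_int.1 hP).irreducible.not_isSquare this
  have habs : J(b | P) = J(b.natAbs | P) := by
    rcases Int.natAbs_eq b with h | h
    · rw [← h]
    · conv_lhs => rw [h]
      rw [jacobiSym.neg _ hPodd, ZMod.χ₄_nat_one_mod_four hP4, one_mul]
  obtain ⟨k, c, hc, hkc⟩ := Nat.exists_eq_two_pow_mul_odd (n := b.natAbs) (by omega)
  have hcop : a.gcd c = 1 := by
    by_contra hne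
    obtain ⟨l, hl, hld⟩ := Nat.exists_prime_and_dvd hne
    have hla : (l : ℤ) ∣ a := (Int.natCast_dvd_natCast.2 hld).trans (Int.gcd_dvd_left a (c : ℤ))
    have hlc : (l : ℤ) ∣ c := (Int.natCast_dvd_natCast.2 hld).trans (Int.gcd_dvd_right a (c : ℤ))
    have hlb : (l : ℤ) ∣ b := by
      rw [← Int.dvd_natAbs, hkc]
      push_cast
      exact hlc.mul_left _
    have h2 : (l : ℤ) * l ∣ P := by
      rw [hPab]
      exact dvd_add (mul_dvd_mul hla hla) (mul_dvd_mul hlb hlb)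
    have h3 : l * l ∣ P := by exact_mod_cast h2
    exact Nat.squarefree_iff_prime_squarefree.1 hP.prime.squarefree l hl h3
  have hcJ : J((c : ℤ) | P) = 1 := by
    rw [← jacobiSym.quadratic_reciprocity_one_mod_four hP4 hc, ← jacobiSym.sq_one' hcop]
    apply jacobiSym.mod_left'
    apply Int.ModEq.symm
    rw [Int.modEq_iff_dvd, hPab]
    have : (c : ℤ) ∣ b := by
      rw [← Int.dvd_natAbs, hkc]
      push_cast
      exact dvd_mul_left _ _
    have h := this.mul_right b
    ring_nf at h ⊢
    exact h
  rw [habs, hkc]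
  push_cast
  rw [jacobiSym.mul_left, hcJ, mul_one, jacobiSym.pow_left, jacobiSym.at_two hPodd,
    ZMod.χ₈_nat_eq_if_mod_eight]
  rcases hn with rfl | rfl
  · have : P % 8 = 1 := by omega
    simp [this, show P % 2 = 1 by omega]
  · have h8 : P % 8 = 5 := by omega
    have hk : k = 1 := by
      rcases k with _ | _ | k
      · have := Nat.odd_iff.1 hc
        simp at hkc
        omega
      · rfl
      · have : b.natAbs = 4 * (2 ^ k * c) := by rw [hkc]; ring
        generalize 2 ^ k * c = t at *
        omega
    simp [h8, hk, show P % 2 = 1 by omega]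

lemma jacobiSym_of_sq_add_sq_sub {P : ℕ} (hP : P.Prime) {a b : ℤ} {e : ℕ}
    (hPab : (P : ℤ) = a * a + b * b) (hP4 : P % 4 = 1)
    (hab : (a - b) % 8 = 1 + 4 * (e % 2 : ℕ)) : J(b - a | P) = (-1) ^ e := by
  have hPodd : Odd P := Nat.odd_iff.2 (by omega)
  obtain ⟨c, hc⟩ : ∃ c : ℕ, c = (a - b).natAbs := ⟨_, rfl⟩
  have hcodd : Odd c := Nat.odd_iff.2 (by omega)
  have habs : J(b - a | P) = J((c : ℤ) | P) := by
    have : b - a = c ∨ b - a = -c := by omega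
    rcases this with h | h
    · rw [h]
    · rw [h, jacobiSym.neg _ hPodd, ZMod.χ₄_nat_one_mod_four hP4, one_mul]
  have hcab : (c : ℤ) * c = (a - b) * (a - b) := by
    rw [hc]; exact Int.natAbs_mul_self' (a - b)
  have hcop : (c : ℤ).gcd P = 1 := by
    rw [Int.gcd_natCast_natCast, Nat.gcd_comm]
    refine (Nat.Prime.coprime_iff_not_dvd hP).2 fun ⟨k, hk⟩ => ?_
    have hk0 : 1 ≤ k := by
      rcases k with _ | k
      · simp at hk; rw [hk] at hcodd; simp at hcodd
      · omega
    have hle : P ≤ c := by rw [hk]; exact Nat.le_mul_of_pos_right _ hk0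
    have h5 : 5 ≤ P := by have := hP.two_le; omega
    have h1 : (P : ℤ) * P ≤ c * c := by exact_mod_cast Nat.mul_le_mul hle hle
    have h2 : (c : ℤ) * c ≤ 2 * P := by rw [hcab, hPab]; nlinarith [sq_nonneg (a + b)]
    have h3 : (5 : ℤ) ≤ P := by exact_mod_cast h5
    nlinarith
  have hne : J((c : ℤ) | P) ≠ 0 := jacobiSym.ne_zero hcop
  have hrec : J((P : ℤ) | c) = J((c : ℤ) | P) :=
    jacobiSym.quadratic_reciprocity_one_mod_four hP4 hcodd
  have hprod : J(2 | c) * J((P : ℤ) | c) = J(a + b | c) ^ 2 := by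
    rw [← jacobiSym.mul_left, ← jacobiSym.pow_left]
    apply jacobiSym.mod_left'
    apply Int.ModEq.symm
    rw [Int.modEq_iff_dvd, hPab]
    refine ⟨c, ?_⟩
    rw [hcab]; ring
  have h2 : J(2 | c) = (-1) ^ e := by
    rw [jacobiSym.at_two hcodd, ZMod.χ₈_nat_eq_if_mod_eight, neg_one_pow_eq_pow_mod_two]
    rcases Nat.mod_two_eq_zero_or_one e with he | he <;> rw [he] at hab ⊢
    · have : c % 8 = 1 ∨ c % 8 = 7 := by omega
      rw [if_neg (by omega), if_pos this, pow_zero]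
    · have : ¬ (c % 8 = 1 ∨ c % 8 = 7) := by omega
      rw [if_neg (by omega), if_neg this, pow_one]
  rw [habs]
  rw [h2, hrec] at hprod
  rcases neg_one_pow_eq_or ℤ e with he | he <;> rw [he] at hprod ⊢ <;>
    rcases jacobiSym.trichotomy (c : ℤ) P with h | h | h <;>
    rcases jacobiSym.trichotomy (a + b) c with h' | h' | h' <;>
    rw [h, h'] at hprod <;> simp_all

lemma cast_pow_eq_jacobiSym {R : Type*} [CommRing R] {P : ℕ} (hP : P.Prime) (h0 : (P : R) = 0)
    (x : ℤ) : (x : R) ^ (P / 2) = (J(x | P) : ℤ) := by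
  have := Fact.mk hP
  have h := legendreSym.eq_pow P x
  rw [jacobiSym.legendreSym.to_jacobiSym] at h
  have h' : ((J(x | P) : ℤ) : ZMod P) = ((x ^ (P / 2) : ℤ) : ZMod P) := by push_cast; exact h
  rw [ZMod.intCast_eq_intCast_iff_dvd_sub] at h'
  obtain ⟨k, hk⟩ := h'
  have := congrArg (Int.cast : ℤ → R) hk
  push_cast at this
  rw [h0, zero_mul] at this
  exact sub_eq_zero.1 this

/-- Supplementary law: the quadratic character of `1 + i` modulo a Gaussian prime. -/
lemma prime_dvd_tt_pow_sub {a b : ℤ} {m n : ℕ} (hp : Prime (⟨a, b⟩ : GaussianInt)) (hm : m ≤ 1)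
    (hb : b % 4 = 2 * n) (hab : (a - b) % 8 = 1 + 4 * ((m + n) % 2 : ℕ)) :
    (⟨a, b⟩ : GaussianInt) ∣ tt ^ (((a * a + b * b).natAbs - 1) / 2) - (-1) ^ m := by
  have hP8 := sq_add_sq_emod_eight hb hab
  set p : GaussianInt := ⟨a, b⟩ with hpdef
  set φ := Ideal.Quotient.mk (Ideal.span {p}) with hφ
  have hφeq : ∀ x y, φ x = φ y ↔ p ∣ x - y := fun x y => by
    rw [hφ, Ideal.Quotient.mk_eq_mk_iff_sub_mem, Ideal.mem_span_singleton]
  rw [← hφeq]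
  simp only [map_pow, map_neg, map_one]
  rcases norm_prime_or_im_eq_zero hp (by omega) (by omega) with hP | ⟨rfl, hP⟩
  · obtain ⟨P, hPdef⟩ : ∃ P, P = (a * a + b * b).natAbs := ⟨_, rfl⟩
    rw [← hPdef] at hP ⊢
    have hPab : (P : ℤ) = a * a + b * b := by
      rw [hPdef]; exact Int.natAbs_of_nonneg (by nlinarith [sq_nonneg a, sq_nonneg b])
    rw [← hPab] at hP8
    have hP0 : ((P : ℕ) : GaussianInt ⧸ Ideal.span {p}) = 0 := by
      have : φ ((P : ℤ) : GaussianInt) = φ 0 := by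
        rw [hφeq, sub_zero, hPab, ← gaussian_norm_mk, Zsqrtd.norm_eq_mul_conj]
        exact dvd_mul_right _ _
      simpa using this
    have hrel : φ tt * (b : GaussianInt ⧸ Ideal.span {p}) = ((b - a : ℤ) : _) := by
      have : φ (tt * (b : GaussianInt)) = φ ((b - a : ℤ) : GaussianInt) := by
        rw [hφeq]
        refine ⟨1, ?_⟩
        ext <;> simp [tt, ii, hpdef]
      simpa using this
    have hpow := congrArg (· ^ (P / 2)) hrel
    simp only [mul_pow] at hpow
    rw [cast_pow_eq_jacobiSym hP hP0, cast_pow_eq_jacobiSym hP hP0,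
      jacobiSym_of_sq_add_sq_even hP hPab hb hP8,
      jacobiSym_of_sq_add_sq_sub hP hPab (by omega) hab] at hpow
    push_cast at hpow
    rw [show (P - 1) / 2 = P / 2 by omega]
    have hu : IsUnit ((-1 : GaussianInt ⧸ Ideal.span {p}) ^ n) := isUnit_one.neg.pow n
    rw [pow_add] at hpow
    exact hu.mul_right_cancel hpow
  · obtain ⟨l, hldef⟩ : ∃ l, l = a.natAbs := ⟨_, rfl⟩
    rw [← hldef] at hP
    have := Fact.mk hP
    have hn : n = 0 := by omega
    subst hn
    have hpl : p ∣ (l : GaussianInt) ∧ (l : GaussianInt) ∣ p := by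
      have hpa : p = (a : GaussianInt) := by ext <;> simp [hpdef]
      rw [hpa]
      have hl : (l : GaussianInt) = ((l : ℤ) : GaussianInt) := by simp
      rw [hl, hldef]
      constructor
      · exact Int.cast_dvd_cast _ _ Int.dvd_natAbs_self
      · exact Int.cast_dvd_cast _ _ Int.natAbs_dvd_self
    have hlprime : Prime (l : GaussianInt) :=
      (associated_of_dvd_dvd hpl.1 hpl.2).prime_iff.1 hp
    have hl3 : l % 4 = 3 := GaussianInt.mod_four_eq_three_of_nat_prime_of_prime l hlprime
    have hl0 : ((l : ℕ) : GaussianInt ⧸ Ideal.span {p}) = 0 := by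
      have : φ (l : GaussianInt) = φ 0 := by
        rw [hφeq, sub_zero]; exact hpl.1
      simpa using this
    have : Nontrivial (GaussianInt ⧸ Ideal.span {p}) :=
      Ideal.Quotient.nontrivial_iff.2 fun h => hp.not_isUnit (Ideal.span_singleton_eq_top.1 h)
    have : CharP (GaussianInt ⧸ Ideal.span {p}) l := (CharP.charP_iff_prime_eq_zero hP).2 hl0
    have hfrob : φ tt ^ l * φ tt = 2 := by
      have hii : ii ^ l = -ii := by
        rw [← Nat.div_add_mod l 4, hl3, pow_add, pow_mul, show ii ^ 4 = 1 by decide, one_pow,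
          one_mul]
        decide
      have h1 : φ tt = 1 + φ ii := by simp [tt]
      rw [h1, add_pow_char, one_pow, ← map_pow, hii]
      have h2 : φ ((1 - ii) * (1 + ii)) = φ 2 := by congr 1
      simp only [map_mul, map_add, map_sub, map_one, map_ofNat] at h2
      rw [← h2, map_neg]
      ring
    have hexp : ((a * a + 0 * 0 : ℤ).natAbs - 1) / 2 = (l + 1) * (l / 2) := by
      rw [show (a * a + 0 * 0 : ℤ) = a * a by ring, Int.natAbs_mul, ← hldef]
      obtain ⟨k, rfl⟩ : ∃ k, l = 2 * k + 1 := ⟨l / 2, by omega⟩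
      rw [show (2 * k + 1) / 2 = k by omega,
        show (2 * k + 1) * (2 * k + 1) = 2 * ((2 * k + 1 + 1) * k) + 1 by ring]
      omega
    rw [hexp, pow_mul, pow_succ, hfrob]
    have h2 := cast_pow_eq_jacobiSym hP hl0 2
    rw [jacobiSym.at_two (Nat.odd_iff.2 (by omega)), ZMod.χ₈_nat_eq_if_mod_eight,
      if_neg (by omega)] at h2
    push_cast at h2
    rw [h2]
    have hm' : m = 0 ∨ m = 1 := by omega
    rcases hm' with rfl | rfl
    · rw [if_pos (by omega), pow_zero]
    · rw [if_neg (by omega), pow_one]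

/-- **Statement 17.**  With `b = i^{s_b}(1+i)^{t_b} p₁^{r₁}⋯p_M^{r_M} q₁²⋯q_N²` and
`d = i^{s_d}(1+i)^{t_d} ∏_{v ∈ V_d} v` a square-free divisor of `b`, let `p = p_{i₀}` with
`p ∤ d`.  Here `E v w` is the edge weight `log_i [Π w/Π v]₄ ∈ ℤ/4ℤ` and `m, n ∈ ℤ/2ℤ`
satisfy `p ≡ (−3)^m (−1+2i)^n (mod (1+i)⁵)`.  Then `d^{(Nm(p)−1)/2} ≡ 1 (mod p)` iff
`deg_d(p) + m·t_d + n·s_d ≡ 0 (mod 2)`. -/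
theorem legendre_symbol_graph_condition
    (M N : ℕ) (p : Fin M → GaussianInt) (q : Fin N → GaussianInt) (r : Fin M → ℕ)
    (sb tb : ℕ) (hsb : sb ≤ 3) (htb : tb ≤ 3) (hr : ∀ i, r i = 1 ∨ r i = 3)
    (hprime : ∀ v : Fin M ⊕ Fin N, Prime (Sum.elim p q v) ∧ IsPrimary (Sum.elim p q v))
    (hdist : Function.Injective (Sum.elim p q))
    (b : GaussianInt)
    (hb : b = ii ^ sb * tt ^ tb * (∏ i, p i ^ r i) * ∏ j, q j ^ 2)
    (sd td : ℕ) (hsd : sd ≤ 1) (htd : td ≤ 1)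
    (Vd : Finset (Fin M ⊕ Fin N)) (d : GaussianInt)
    (hd : d = ii ^ sd * tt ^ td * ∏ v ∈ Vd, Sum.elim p q v)
    (i₀ : Fin M) (hi₀ : Sum.inl i₀ ∉ Vd)
    (E : (Fin M ⊕ Fin N) → (Fin M ⊕ Fin N) → ZMod 4)
    (hE : ∀ v w, v ≠ w → Sum.elim p q v ∣
      (Sum.elim p q w ^ (((Sum.elim p q v).norm.natAbs - 1) / 4) - ii ^ (E v w).val))
    (hE0 : ∀ v, E v v = 0)
    (m n : ZMod 2)
    (hmn : tt ^ 5 ∣ (p i₀ - (-3) ^ m.val * (-1 + 2 * ii) ^ n.val)) :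
    (p i₀ ∣ (d ^ (((p i₀).norm.natAbs - 1) / 2) - 1)) ↔
      (∑ w ∈ Vd, c2 (E (Sum.inl i₀) w)) + m * (td : ZMod 2) + n * (sd : ZMod 2) = 0 := by
  have hpP : Prime (p i₀) := (hprime (Sum.inl i₀)).1
  obtain ⟨a, c, hac⟩ : ∃ a c : ℤ, p i₀ = ⟨a, c⟩ := ⟨_, _, rfl⟩
  have hE' := fun w hw => hE (Sum.inl i₀) w hw
  simp only [Sum.elim_inl] at hE'
  rw [hac] at hmn hpP hE' ⊢
  clear hprime
  obtain ⟨hc, hab⟩ := coords_of_tt_pow_five_dvd hmn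
  have hN8 := sq_add_sq_emod_eight hc hab
  have htt := prime_dvd_tt_pow_sub hpP (Nat.lt_succ_iff.1 m.val_lt) hc hab
  rw [gaussian_norm_mk] at hE' ⊢
  obtain ⟨P, hP⟩ : ∃ P, P = (a * a + c * c).natAbs := ⟨_, rfl⟩
  have hPZ : (P : ℤ) = a * a + c * c := by
    rw [hP]; exact Int.natAbs_of_nonneg (by nlinarith [sq_nonneg a, sq_nonneg c])
  rw [← hPZ] at hN8
  rw [← hP] at htt hE' ⊢
  set π : GaussianInt := ⟨a, c⟩ with hπ
  set φ := Ideal.Quotient.mk (Ideal.span {π}) with hφ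
  have hφeq : ∀ x y, φ x = φ y ↔ π ∣ x - y := fun x y => by
    rw [hφ, Ideal.Quotient.mk_eq_mk_iff_sub_mem, Ideal.mem_span_singleton]
  have hhalf : (P - 1) / 2 = 2 * ((P - 1) / 4) := by omega
  have hii2 : ii ^ 2 = -1 := by decide
  have hi : φ ii ^ ((P - 1) / 2) = (-1) ^ n.val := by
    rw [hhalf, pow_mul, ← map_pow, hii2, map_neg, map_one, neg_one_pow_eq_pow_mod_two,
      neg_one_pow_eq_pow_mod_two n.val]
    congr 1
    omega
  have ht : φ tt ^ ((P - 1) / 2) = (-1) ^ m.val := by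
    have := (hφeq _ _).2 htt
    simpa using this
  have hw : ∀ w ∈ Vd, φ (Sum.elim p q w) ^ ((P - 1) / 2) = (-1) ^ (E (Sum.inl i₀) w).val := by
    intro w hwV
    have h := (hφeq _ _).2 (hE' w (by rintro rfl; exact hi₀ hwV))
    rw [map_pow, map_pow] at h
    rw [hhalf, mul_comm 2, pow_mul, h, ← pow_mul, mul_comm, pow_mul, ← map_pow, hii2, map_neg,
      map_one]
  obtain ⟨K, hK⟩ : ∃ K, K = n.val * sd + m.val * td + ∑ w ∈ Vd, (E (Sum.inl i₀) w).val :=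
    ⟨_, rfl⟩
  have hdK : φ d ^ ((P - 1) / 2) = (-1) ^ K := by
    rw [hd, map_mul, map_mul, map_prod, map_pow, map_pow, mul_pow, mul_pow, ← Finset.prod_pow,
      Finset.prod_congr rfl hw, Finset.prod_pow_eq_pow_sum, ← pow_mul, ← pow_mul, mul_comm sd,
      mul_comm td, pow_mul, hi, pow_mul, ht, hK, pow_add, pow_add, pow_mul, pow_mul]
  have hKcast : (∑ w ∈ Vd, c2 (E (Sum.inl i₀) w)) + m * (td : ZMod 2) + n * (sd : ZMod 2)
      = (K : ZMod 2) := by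
    have hc2 : ∀ x : ZMod 4, c2 x = (x.val : ZMod 2) := by
      intro x
      conv_lhs => rw [← ZMod.natCast_zmod_val x]
      exact map_natCast c2 _
    rw [hK]
    push_cast
    rw [ZMod.natCast_zmod_val, ZMod.natCast_zmod_val, Finset.sum_congr rfl fun w _ => hc2 _]
    ring
  have h2 : ¬ π ∣ 2 := by
    rintro ⟨u, hu⟩
    have hcast : (2 : GaussianInt) = ⟨2, 0⟩ := by decide
    have hnorm := congrArg Zsqrtd.norm hu
    rw [Zsqrtd.norm_mul, hcast, gaussian_norm_mk, hπ, gaussian_norm_mk, ← hPZ] at hnorm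
    have hdvd : P ∣ 2 ^ 2 := by
      have : (P : ℤ) ∣ ((2 ^ 2 : ℕ) : ℤ) := ⟨u.norm, by simpa using hnorm⟩
      exact_mod_cast this
    have hle := Nat.le_of_dvd (by norm_num) hdvd
    have hP1 : P = 1 := by omega
    refine hpP.not_isUnit (Zsqrtd.norm_eq_one_iff.1 ?_)
    rw [hπ, gaussian_norm_mk, ← hP, hP1]
  rw [hKcast, ← hφeq, map_pow, hdK, map_one, ZMod.natCast_eq_zero_iff_even]
  rcases Nat.even_or_odd K with hKe | hKo
  · simp [hKe, hKe.neg_one_pow]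
  · have hne : ¬ (-1 : GaussianInt ⧸ Ideal.span {π}) = 1 := by
      intro h
      apply h2
      have : φ 1 = φ (-1) := by rw [map_neg, map_one]; exact h.symm
      rwa [hφeq, show (1 - -1 : GaussianInt) = 2 by decide] at this
    rw [hKo.neg_one_pow]
    exact ⟨fun h => absurd h hne, fun h => absurd hKo (Nat.not_odd_iff_even.2 h)⟩
end
end

section
/- Suppose b = (−1)^{s}(1+i)^{2t} q₁²⋯q_N² with s, t ∈ {0,1} and q₁, …, q_N distinct primary primes each congruent to 1 modulo (1+i)⁷. Let d = i^{s_d}(1+i)^{t_d} ∏_{j ∈ S} q_j be a square-free divisor of b (s_d, t_d ∈ {0,1}, S ⊆ {1,…,N}), and let 𝟙^{(d)} ∈ 𝔽₂^N be the vector with j-th entry 1 exactly when j ∈ S. Then C_d(ℚ(i)_v) ≠ ∅ for every odd prime v dividing b if and only if the mod-2 reduction of the Laplacian L(G_b) satisfies L(G_b) · 𝟙^{(d)} = 0 over 𝔽₂. -/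
open IsDedekindDomain

noncomputable section

/-- The Laplacian `L(G_b) = diag(deg(q₁),…,deg(q_N)) − A(G_b)` over `ℤ/4ℤ` of the weighted
graph on the vertices `q₁,…,q_N` with edge weights `E`. -/
def LapQ {N : ℕ} (E : Fin N → Fin N → ZMod 4) : Matrix (Fin N) (Fin N) (ZMod 4) :=
  fun v w => (if v = w then ∑ u, E v u else 0) - E v w

theorem Valued.tendsto_zero_of_v_le_pow {K Γ₀ : Type*} [Field K]
    [LinearOrderedCommGroupWithZero Γ₀] [MulArchimedean Γ₀] [Valued K Γ₀] {u : ℕ → K} {r : Γ₀}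
    (hr : r < 1) (hu : ∀ n, Valued.v (u n) ≤ r ^ (n + 1)) :
    Filter.Tendsto u Filter.atTop (nhds 0) := by
  simp only [(Valued.hasBasis_nhds_zero _ _).tendsto_right_iff, Set.mem_ofPred_eq,
    Filter.eventually_atTop, forall_const]
  intro y
  let v : Valuation K Γ₀ := Valued.v
  obtain ⟨n, hn⟩ := exists_pow_lt₀ hr
    (Units.map (MonoidWithZeroHom.ValueGroup₀.embedding (f := (.ofClass v))) y)
  refine ⟨n, fun m hm ↦ ?_⟩
  rw [Valuation.restrict_lt_iff_lt_embedding]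
  refine hn.trans_le' ((hu m).trans ?_)
  exact pow_le_pow_right_of_le_one' hr.le (by omega)

/-- Hensel's lemma for square roots: if `2` is a unit, one-units are squares. -/
theorem Valued.isSquare_of_v_sub_one_lt {K Γ₀ : Type*} [Field K]
    [LinearOrderedCommGroupWithZero Γ₀] [MulArchimedean Γ₀] [Valued K Γ₀] [CompleteSpace K]
    (h2 : Valued.v (2 : K) = 1) {x : K} (hx : Valued.v (x - 1) < 1) : IsSquare x := by
  have h20 : (2 : K) ≠ 0 := by
    intro h; rw [h, map_zero] at h2; exact zero_ne_one h2
  set r := Valued.v (x - 1) with hr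
  let y : ℕ → K := fun n => Nat.rec 1 (fun _ z => z - (z ^ 2 - x) / 2) n
  have hy0 : y 0 = 1 := rfl
  have hys : ∀ n, y (n + 1) = y n - (y n ^ 2 - x) / 2 := fun n => rfl
  have key : ∀ n, Valued.v (y n - 1) ≤ r ∧ Valued.v (y n ^ 2 - x) ≤ r ^ (n + 1) := by
    intro n
    induction n with
    | zero =>
      refine ⟨by simp [hy0], ?_⟩
      rw [hy0, ← Valuation.map_neg]
      simp [hr]
    | succ n ih =>
      obtain ⟨h1, he⟩ := ih
      have her : Valued.v (y n ^ 2 - x) ≤ r :=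
        he.trans (by simpa using pow_le_pow_right_of_le_one' hx.le (show 1 ≤ n + 1 by omega))
      constructor
      · rw [show y (n + 1) - 1 = (y n - 1) - (y n ^ 2 - x) / 2 by rw [hys]; ring]
        refine (Valuation.map_sub _ _ _).trans (max_le h1 ?_)
        rwa [map_div₀, h2, div_one]
      · rw [show y (n + 1) ^ 2 - x = (y n ^ 2 - x) * ((y n ^ 2 - x) / 2 / 2 - (y n - 1)) by
          rw [hys]; field_simp; ring]
        rw [map_mul, pow_succ _ (n + 1)]
        refine mul_le_mul' he ((Valuation.map_sub _ _ _).trans (max_le ?_ h1))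
        rwa [map_div₀, map_div₀, h2, div_one, div_one]
  have he0 : Filter.Tendsto (fun n => y n ^ 2 - x) Filter.atTop (nhds 0) :=
    Valued.tendsto_zero_of_v_le_pow hx fun n => (key n).2
  have hna : NonarchimedeanRing K := by
    have := (Valued.v (R := K)).subgroups_basis.nonarchimedean
    convert this
    exact congrArg (fun u : UniformSpace K => u.toTopologicalSpace)
      (Valued.toUniformSpace_eq K Γ₀)
  have hs : Summable fun n => (y n ^ 2 - x) / 2 := by
    apply NonarchimedeanAddGroup.summable_of_tendsto_cofinite_zero
    rw [Nat.cofinite_eq_atTop]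
    simpa using he0.div_const 2
  have hyt : Filter.Tendsto y Filter.atTop (nhds (1 - ∑' n, (y n ^ 2 - x) / 2)) := by
    have := hs.hasSum.tendsto_sum_nat.const_sub 1
    refine this.congr fun n => ?_
    induction n with
    | zero => simp [hy0]
    | succ n ih => rw [Finset.sum_range_succ, hys, ← ih]; ring
  have := tendsto_nhds_unique he0 ((hyt.pow 2).sub_const x)
  exact ⟨1 - ∑' n, (y n ^ 2 - x) / 2, by linear_combination this⟩

section
variable {K : Type*} [Field K] {Γ : Type*} [LinearOrderedCommGroupWithZero Γ] {V : Valuation K Γ}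

theorem IsSquare.of_mul_sq_right {x y : K} (hy : y ≠ 0) (h : IsSquare (x * y ^ 2)) :
    IsSquare x := by
  obtain ⟨r, hr⟩ := h
  exact ⟨r / y, by field_simp; linear_combination hr⟩

theorem isSquare_mul_right_iff {x y : K} (hy : y ≠ 0) (h : IsSquare y) :
    IsSquare (x * y) ↔ IsSquare x := by
  obtain ⟨r, rfl⟩ := h
  have hr : r ≠ 0 := by rintro rfl; simp at hy
  rw [← sq]
  exact ⟨IsSquare.of_mul_sq_right hr, fun h => h.mul (IsSquare.sq r)⟩

theorem isSquare_mul_of_valuation_sub_lt (hsq : ∀ x : K, V (x - 1) < 1 → IsSquare x)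
    {a c : K} (h : V (a - c) < V a) : IsSquare (a * c) := by
  have ha : a ≠ 0 := by rintro rfl; simp at h
  have h1 : IsSquare (c / a) := by
    apply hsq
    rw [div_sub_one ha, map_div₀, Valuation.map_sub_swap]
    exact (div_lt_one₀ (by simpa [zero_lt_iff] using ha)).2 h
  have : a * c = c / a * a ^ 2 := by field_simp
  rw [this]
  exact h1.mul (IsSquare.sq a)

/-- Over a valued field in which `-1` and all one-units are squares, `a² - c²` is a nonzero square
as soon as `a` and `c` have distinct valuations. -/
theorem isSquare_sq_sub_sq (hsq : ∀ x : K, V (x - 1) < 1 → IsSquare x)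
    (hneg : IsSquare (-1 : K)) {a c : K} (h : V a ≠ V c) :
    a ^ 2 - c ^ 2 ≠ 0 ∧ IsSquare (a ^ 2 - c ^ 2) := by
  have main : ∀ a c : K, V c < V a → a ^ 2 - c ^ 2 ≠ 0 ∧ IsSquare (a ^ 2 - c ^ 2) := by
    intro a c h
    have ha : a ≠ 0 := by rintro rfl; simp at h
    constructor
    · intro h0
      have : V a ^ 2 = V c ^ 2 := by rw [← map_pow, ← map_pow, sub_eq_zero.1 h0]
      exact (pow_lt_pow_left₀ h zero_le two_ne_zero).ne' this
    · have h1 : IsSquare (a ^ 2 * (a ^ 2 - c ^ 2)) := by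
        apply isSquare_mul_of_valuation_sub_lt hsq (V := V)
        rw [sub_sub_cancel, map_pow, map_pow]
        exact pow_lt_pow_left₀ h zero_le two_ne_zero
      rw [mul_comm] at h1
      exact h1.of_mul_sq_right ha
  rcases lt_or_gt_of_ne h with h | h
  · obtain ⟨h0, h1⟩ := main c a h
    refine ⟨fun h2 => h0 (by linear_combination -h2), ?_⟩
    rw [← neg_sub, ← neg_one_mul]
    exact hneg.mul h1
  · exact main a c h

theorem isSquare_of_mul_sq_eq {d w y : K} (hy : y ≠ 0 ∧ IsSquare y) (h : d * w ^ 2 = y) :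
    IsSquare d := by
  obtain ⟨hy0, hy⟩ := hy
  rw [← h] at hy0 hy
  exact hy.of_mul_sq_right fun hw => hy0 (by simp [hw])

theorem localPoint_iff_of_valuation_eq_one (hsq : ∀ x : K, V (x - 1) < 1 → IsSquare x)
    (hneg : IsSquare (-1 : K)) (h2 : V 2 = 1) {d β b : K} (hb : b = β ^ 2) (hβ : ¬ IsSquare (V β))
    (hd : V d = 1) :
    ((∃ z w : K, d * w ^ 2 = d ^ 2 - 4 * b * z ^ 4) ∨ ∃ u : K, u ^ 2 * d = b) ↔ IsSquare d := by
  subst hb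
  constructor
  · rintro (⟨z, w, h⟩ | ⟨u, h⟩)
    · refine isSquare_of_mul_sq_eq (isSquare_sq_sub_sq hsq hneg (a := d) (c := 2 * β * z ^ 2) ?_)
        (h.trans (by ring))
      rw [hd, map_mul, map_mul, h2, one_mul, map_pow]
      intro h1
      have hz : V z ≠ 0 := by rintro hz; simp [hz] at h1
      exact hβ ⟨(V z)⁻¹, by rw [← sq, inv_pow]; exact eq_inv_of_mul_eq_one_left h1.symm⟩
    · have hβ0 : β ≠ 0 := by rintro rfl; simp at hβ
      exact isSquare_of_mul_sq_eq (w := u) (y := β ^ 2) ⟨pow_ne_zero 2 hβ0, IsSquare.sq β⟩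
        (by linear_combination h)
  · rintro ⟨r, hr⟩
    exact Or.inl ⟨0, r, by rw [hr]; ring⟩

theorem localPoint_iff_of_valuation_eq (hsq : ∀ x : K, V (x - 1) < 1 → IsSquare x)
    (hneg : IsSquare (-1 : K)) (h2 : V 2 = 1) {d β b : K} (hb : b = β ^ 2) (hβ : ¬ IsSquare (V β))
    (hd : V d = V β) :
    ((∃ z w : K, d * w ^ 2 = d ^ 2 - 4 * b * z ^ 4) ∨ ∃ u : K, u ^ 2 * d = b) ↔
      IsSquare (2 * β * d) := by
  subst hb
  have hβ0 : β ≠ 0 := by rintro rfl; simp at hβ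
  have h20 : (2 : K) ≠ 0 := by rintro h; simp [h] at h2
  have hdsq : ¬ IsSquare d := fun h => hβ (hd ▸ h.map V)
  constructor
  · rintro (⟨z, w, h⟩ | ⟨u, h⟩)
    · have hd0 : d ≠ 0 := by rintro rfl; simp at hdsq
      by_cases hv : V d = V (2 * β * z ^ 2)
      · have hz : z ≠ 0 := by rintro rfl; simp [hd0] at hv
        have hlt : V (d - 2 * β * z ^ 2) < V d ∨ V (d - -(2 * β * z ^ 2)) < V d := by
          by_contra! hcon
          have e1 := (Valuation.map_sub V d (2 * β * z ^ 2)).antisymm (by simpa [← hv] using hcon.1)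
          have e2 := (Valuation.map_sub V d (-(2 * β * z ^ 2))).antisymm
            (by simpa [-sub_neg_eq_add, ← hv] using hcon.2)
          rw [Valuation.map_neg] at e2
          rw [← hv, max_self] at e1 e2
          have h3 := congrArg V (h.trans (show d ^ 2 - 4 * β ^ 2 * z ^ 4
            = (d - 2 * β * z ^ 2) * (d - -(2 * β * z ^ 2)) by ring))
          rw [map_mul, map_mul, e1, e2, map_pow] at h3
          have h4 := mul_left_cancel₀ (by simpa using hd0) h3
          exact hβ ⟨V w, by rw [← hd, ← h4, sq]⟩
        have hs : IsSquare (d * (2 * β * z ^ 2)) := by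
          rcases hlt with h | h
          · exact isSquare_mul_of_valuation_sub_lt hsq h
          · rw [show d * (2 * β * z ^ 2) = -1 * (d * -(2 * β * z ^ 2)) by ring]
            exact hneg.mul (isSquare_mul_of_valuation_sub_lt hsq h)
        exact IsSquare.of_mul_sq_right hz (by convert hs using 1; ring)
      · exact absurd (isSquare_of_mul_sq_eq (isSquare_sq_sub_sq hsq hneg hv)
          (h.trans (by ring))) hdsq
    · exact absurd (isSquare_of_mul_sq_eq (w := u) (y := β ^ 2) ⟨pow_ne_zero 2 hβ0, IsSquare.sq β⟩
        (by linear_combination h)) hdsq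
  · rintro ⟨r, hr⟩
    refine Or.inl ⟨r / (2 * β), 0, ?_⟩
    field_simp
    linear_combination (-4) * (2 * β * d + r * r) * hr

end


section
open HeightOneSpectrum
variable {R : Type*} [CommRing R] [IsDedekindDomain R] (K : Type*) [Field K] [Algebra R K]
  [IsFractionRing R K] (v : HeightOneSpectrum R)

theorem IsDedekindDomain.HeightOneSpectrum.valued_algebraMap_lt_one_iff (r : R) :
    Valued.v (algebraMap R (v.adicCompletion K) r) < 1 ↔ r ∈ v.asIdeal := by
  rw [← v.valuation_lt_one_iff_mem (K := K)]
  exact (valuedAdicCompletion_eq_valuation (K := K) v r).symm ▸ Iff.rfl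

theorem IsDedekindDomain.HeightOneSpectrum.valued_algebraMap_eq_one_iff (r : R) :
    Valued.v (algebraMap R (v.adicCompletion K) r) = 1 ↔ r ∉ v.asIdeal := by
  rw [← v.valuation_eq_one_iff_notMem (K := K)]
  exact (valuedAdicCompletion_eq_valuation (K := K) v r).symm ▸ Iff.rfl

theorem IsDedekindDomain.HeightOneSpectrum.exists_valued_sub_algebraMap_lt_one
    (w : v.adicCompletion K) (hw : Valued.v w ≤ 1) :
    ∃ r : R, Valued.v (w - algebraMap R (v.adicCompletion K) r) < 1 := by
  have hU : {y : v.adicCompletion K | Valued.v (y - w) < 1} ∈ nhds w :=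
    Valued.mem_nhds.2 ⟨1, fun y hy => by
      simpa using (Valuation.restrict_lt_iff_lt_embedding _).1 hy⟩
  obtain ⟨_, hk, k, rfl⟩ := mem_closure_iff_nhds.1 (denseRange_algebraMap K v w) _ hU
  have hk : Valued.v (algebraMap K (v.adicCompletion K) k - w) < 1 := hk
  have e : ∀ k : K, Valued.v (algebraMap K (v.adicCompletion K) k) = v.valuation K k :=
    fun k => valuedAdicCompletion_eq_valuation' v k
  have hk1 : v.valuation K k ≤ 1 := by
    rw [← e, show algebraMap K (v.adicCompletion K) k = (algebraMap K _ k - w) + w by ring]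
    exact (Valuation.map_add _ _ _).trans (max_le hk.le hw)
  obtain ⟨a, ha⟩ := v.exists_valuation_sub_lt_of_integer hk1 1
  refine ⟨a, ?_⟩
  rw [← e, map_sub, ← IsScalarTower.algebraMap_apply] at ha
  rw [show w - algebraMap R (v.adicCompletion K) a =
    -((algebraMap R _ a - algebraMap K _ k) + (algebraMap K _ k - w)) by ring, Valuation.map_neg]
  exact (Valuation.map_add _ _ _).trans_lt (max_lt (by simpa using ha) hk)

/-- An element of `R` outside a prime of odd residue characteristic is a square in the completion
if and only if it is a square in the residue field. -/
theorem IsDedekindDomain.HeightOneSpectrum.isSquare_algebraMap_adicCompletion_iff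
    (hsq : ∀ x : v.adicCompletion K, Valued.v (x - 1) < 1 → IsSquare x)
    {x : R} (hx : x ∉ v.asIdeal) :
    IsSquare (algebraMap R (v.adicCompletion K) x) ↔
      IsSquare (Ideal.Quotient.mk v.asIdeal x) := by
  have hx1 := (v.valued_algebraMap_eq_one_iff K x).2 hx
  constructor
  · rintro ⟨w, hw⟩
    have hw1 : Valued.v w = 1 := by
      rw [hw, map_mul, ← sq] at hx1
      exact (pow_eq_one_iff_of_nonneg zero_le two_ne_zero).1 hx1
    obtain ⟨r, hr⟩ := v.exists_valued_sub_algebraMap_lt_one K w hw1.le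
    refine ⟨Ideal.Quotient.mk _ r, ?_⟩
    rw [← map_mul, Ideal.Quotient.eq, ← v.valued_algebraMap_lt_one_iff K, map_sub, map_mul, hw,
      show ∀ s : v.adicCompletion K, w * w - s * s = (w - s) * (w + s) by intro s; ring, map_mul]
    refine mul_lt_one_of_lt_of_le hr ((Valuation.map_add _ _ _).trans (max_le hw1.le ?_))
    exact (valuedAdicCompletion_eq_valuation (K := K) v r).le.trans (v.valuation_le_one r)
  · rintro ⟨y, hy⟩
    obtain ⟨r, rfl⟩ := Ideal.Quotient.mk_surjective y
    rw [← map_mul, Ideal.Quotient.eq, ← Ideal.neg_mem_iff, neg_sub,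
      ← v.valued_algebraMap_lt_one_iff K, map_sub, map_mul] at hy
    have hr : r ∉ v.asIdeal := by
      intro hr
      have h1 : Valued.v (algebraMap R (v.adicCompletion K) r) < 1 :=
        (v.valued_algebraMap_lt_one_iff K r).2 hr
      have h2 := Valuation.map_sub_lt _
        (show Valued.v (algebraMap R (v.adicCompletion K) r * algebraMap R _ r) < 1 by
          rw [map_mul]; exact mul_lt_one_of_lt_of_le h1 h1.le) hy
      rw [sub_sub_cancel, hx1] at h2
      exact lt_irrefl _ h2
    have hr1 := (v.valued_algebraMap_eq_one_iff K r).2 hr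
    have hr0 : algebraMap R (v.adicCompletion K) r ≠ 0 := by intro h; simp [h] at hr1
    have := isSquare_mul_of_valuation_sub_lt hsq (V := Valued.v)
      (a := algebraMap R (v.adicCompletion K) r * algebraMap R _ r) (c := algebraMap R _ x)
      (by rwa [map_mul, hr1, mul_one])
    exact IsSquare.of_mul_sq_right hr0 (by convert this using 1; ring)

end

/-- The coordinates of a Gaussian integer in the basis `1, i`. -/
def GaussianInt.coordEquiv : GaussianInt ≃ₗ[ℤ] (Fin 2 → ℤ) where
  toFun z := ![z.re, z.im]
  invFun f := ⟨f 0, f 1⟩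
  map_add' x y := by ext i; fin_cases i <;> simp
  map_smul' c x := by ext i; fin_cases i <;> simp
  left_inv x := by simp
  right_inv f := by ext i; fin_cases i <;> simp

theorem GaussianInt.card_quotient_span (π : GaussianInt) :
    Nat.card (GaussianInt ⧸ Ideal.span {π}) = π.norm.natAbs := by
  let b := Module.Basis.ofEquivFun GaussianInt.coordEquiv
  have : Module.Free ℤ GaussianInt := .of_basis b
  have : Module.Finite ℤ GaussianInt := .of_basis b
  have h : Algebra.norm ℤ π = π.norm := by
    rw [Algebra.norm_eq_matrix_det b, Matrix.det_fin_two]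
    simp [Algebra.leftMulMatrix_apply, LinearMap.toMatrix_apply, b, GaussianInt.coordEquiv,
      Zsqrtd.norm_def]
  rw [← h, ← Ideal.absNorm_span_singleton, Ideal.absNorm_apply, Submodule.cardQuot_apply]

theorem GaussianInt.isSquare_mk_span_iff {π : GaussianInt} (hπ : Prime π)
    (hodd : π.norm.natAbs % 2 = 1) {x : GaussianInt} (hx : ¬ π ∣ x) :
    IsSquare (Ideal.Quotient.mk (Ideal.span {π}) x) ↔
      Ideal.Quotient.mk (Ideal.span {π}) (x ^ (π.norm.natAbs / 2)) = 1 := by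
  have : (Ideal.span {π}).IsMaximal := PrincipalIdealRing.isMaximal_of_irreducible hπ.irreducible
  let : Field (GaussianInt ⧸ Ideal.span {π}) := Ideal.Quotient.field _
  have hcard := GaussianInt.card_quotient_span π
  have : Finite (GaussianInt ⧸ Ideal.span {π}) := Nat.finite_of_card_ne_zero (by omega)
  have := Fintype.ofFinite (GaussianInt ⧸ Ideal.span {π})
  rw [Nat.card_eq_fintype_card] at hcard
  have hchar : ringChar (GaussianInt ⧸ Ideal.span {π}) ≠ 2 := by
    rw [Ne, FiniteField.even_card_iff_char_two, hcard]; omega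
  have hx0 : Ideal.Quotient.mk (Ideal.span {π}) x ≠ 0 := by
    rwa [Ne, Ideal.Quotient.eq_zero_iff_mem, Ideal.mem_span_singleton]
  rw [FiniteField.isSquare_iff hchar hx0, hcard, map_pow]

/-- A Gaussian prime off both coordinate axes has prime norm. -/
theorem GaussianInt.exists_prime_norm_eq {π : GaussianInt} (hπ : Prime π) (hre : π.re ≠ 0)
    (him : π.im ≠ 0) : ∃ p : ℕ, p.Prime ∧ π.norm = p := by
  have : (Ideal.span {π}).IsMaximal := PrincipalIdealRing.isMaximal_of_irreducible hπ.irreducible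
  let : Field (GaussianInt ⧸ Ideal.span {π}) := Ideal.Quotient.field _
  have hcard := GaussianInt.card_quotient_span π
  have hN0 : π.norm.natAbs ≠ 0 := by
    rw [Ne, Int.natAbs_eq_zero, GaussianInt.norm_eq_zero]; exact hπ.ne_zero
  have : Finite (GaussianInt ⧸ Ideal.span {π}) := Nat.finite_of_card_ne_zero (by omega)
  obtain ⟨p, hchar⟩ := CharP.exists (GaussianInt ⧸ Ideal.span {π})
  have hp : p.Prime := (CharP.char_is_prime_or_zero (GaussianInt ⧸ Ideal.span {π}) p).resolve_right
    (CharP.char_ne_zero_of_finite (GaussianInt ⧸ Ideal.span {π}) p)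
  have hdvd : π ∣ (p : GaussianInt) := by
    rw [← Ideal.mem_span_singleton, ← Ideal.Quotient.eq_zero_iff_mem, map_natCast]
    exact CharP.cast_eq_zero (GaussianInt ⧸ Ideal.span {π}) p
  refine ⟨p, hp, ?_⟩
  obtain ⟨u, hu⟩ := hdvd
  have hmul : p ^ 2 = π.norm.natAbs * u.norm.natAbs := by
    rw [← Int.natAbs_mul, ← Zsqrtd.norm_mul, ← hu, Zsqrtd.norm_natCast, Int.natAbs_mul,
      Int.natAbs_natCast, sq]
  have hunit : ¬ u.norm.natAbs = 1 := by
    intro h1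
    have h1' : u.re * u.re + u.im * u.im = 1 := by
      have := GaussianInt.abs_natCast_norm u
      rw [h1, Zsqrtd.norm_def] at this
      push_cast at this; linarith
    have hr := congrArg Zsqrtd.re hu
    have hi := congrArg Zsqrtd.im hu
    simp only [Zsqrtd.re_natCast, Zsqrtd.im_natCast, Zsqrtd.re_mul, Zsqrtd.im_mul] at hr hi
    have e1 : π.re = p * u.re := by linear_combination π.re * -h1' - u.re * hr - u.im * hi
    have e2 : π.im = -(p * u.im) := by linear_combination π.im * -h1' + u.im * hr - u.re * hi
    have hur : u.re ≠ 0 := by rintro h; simp [h] at e1; exact hre e1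
    have hui : u.im ≠ 0 := by rintro h; simp [h] at e2; exact him e2
    have := mul_self_pos.2 hur
    have := mul_self_pos.2 hui
    omega
  obtain ⟨k, hk, hk'⟩ := (Nat.dvd_prime_pow hp).1 (Dvd.intro _ hmul.symm)
  have : π.norm.natAbs = p := by
    interval_cases k
    · exact absurd (Zsqrtd.norm_eq_one_iff.1 (by simpa using hk')) hπ.not_isUnit
    · simpa using hk'
    · rw [hk'] at hmul
      exact absurd (Nat.eq_of_mul_eq_mul_left (pow_pos hp.pos 2) (hmul.symm.trans (mul_one _).symm))
        hunit
  rw [← this, GaussianInt.abs_natCast_norm]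

/-- Quadratic symbols of an integer `b` and of `b - a` modulo a prime `a² + b²`. -/
theorem isSquare_mul_sub_of_prime_sq_add_sq {p : ℕ} [Fact p.Prime] {a b : ℤ}
    (hp : (p : ℤ) = a ^ 2 + b ^ 2) (ha : a % 8 = 1) (hb : b % 8 = 0) (hb0 : b ≠ 0) :
    IsSquare ((b * (b - a) : ℤ) : ZMod p) := by
  have hab : IsCoprime a b := by
    have hsf := (Fact.out : p.Prime).prime.irreducible.squarefree (Int.gcd a b) (by
      zify
      rw [hp, ← sq]
      exact dvd_add (pow_dvd_pow_of_dvd (Int.gcd_dvd_left _ _) 2)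
        (pow_dvd_pow_of_dvd (Int.gcd_dvd_right _ _) 2))
    exact Int.isCoprime_iff_gcd_eq_one.2 (Nat.isUnit_iff.1 hsf)
  have hp8 : p % 8 = 1 := by
    obtain ⟨x, hx⟩ : ∃ x, a = 8 * x + 1 := ⟨a / 8, by omega⟩
    obtain ⟨y, hy⟩ : ∃ y, b = 8 * y := ⟨b / 8, by omega⟩
    have : (p : ℤ) = 8 * (8 * x ^ 2 + 2 * x + 8 * y ^ 2) + 1 := by rw [hp, hx, hy]; ring
    omega
  have hodd : Odd p := Nat.odd_iff.2 (by omega)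
  have hflip : ∀ m : ℕ, Odd m → jacobiSym m p = jacobiSym p m := fun m hm =>
    jacobiSym.quadratic_reciprocity_one_mod_four' hm (by omega)
  have hneg : ∀ c : ℤ, jacobiSym c p = jacobiSym c.natAbs p := by
    intro c
    rcases Int.natAbs_eq c with h | h
    · rw [← h]
    · conv_lhs => rw [h]
      rw [jacobiSym.neg _ hodd, ZMod.χ₄_nat_one_mod_four (by omega), one_mul]
  have h2 : jacobiSym 2 p = 1 := by
    rw [jacobiSym.at_two hodd, ZMod.χ₈_nat_eq_if_mod_eight]
    simp [hp8, show p % 2 = 1 by omega]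
  apply ZMod.isSquare_of_jacobiSym_eq_one
  have h1 : jacobiSym b p = 1 := by
    obtain ⟨k, c, hc, hbc⟩ := Nat.exists_eq_two_pow_mul_odd (Int.natAbs_ne_zero.2 hb0)
    have hcb : (c : ℤ) ∣ b := Int.natCast_dvd.2 (hbc ▸ Dvd.intro_left _ rfl)
    rw [hneg, hbc]
    push_cast
    rw [jacobiSym.mul_left, jacobiSym.pow_left, h2, one_pow, one_mul, hflip c hc, hp,
      jacobiSym.mod_left' (a₂ := a ^ 2)]
    · exact jacobiSym.sq_one' (Int.isCoprime_iff_gcd_eq_one.1 (hab.of_isCoprime_of_dvd_right hcb))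
    · apply Int.ModEq.symm
      rw [Int.modEq_iff_dvd, add_sub_cancel_left]
      exact hcb.trans (dvd_pow_self b two_ne_zero)
  have h3 : jacobiSym (b - a) p = 1 := by
    have hm : Odd (b - a).natAbs := by rw [Int.natAbs_odd, Int.odd_iff]; omega
    rw [hneg, hflip _ hm, hp, jacobiSym.mod_left' (a₂ := 2 * a ^ 2), jacobiSym.mul_left,
      jacobiSym.at_two hm, ZMod.χ₈_nat_eq_if_mod_eight, if_neg (by grind), if_pos (by omega),
      one_mul]
    · apply jacobiSym.sq_one'
      have : IsCoprime a (b - a) := by simpa [sub_eq_add_neg] using hab.add_mul_left_right (-1)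
      simpa only [Int.gcd, Int.natAbs_natCast] using Int.isCoprime_iff_gcd_eq_one.1 this
    · apply Int.ModEq.symm
      rw [Int.modEq_iff_dvd, Int.natAbs_dvd]
      exact ⟨b + a, by ring⟩
  rw [jacobiSym.mul_left, h1, h3, one_mul]

theorem ii_sq : ii ^ 2 = -1 := by
  rw [sq]; ext <;> simp [ii]

theorem isUnit_ii : IsUnit ii :=
  .of_mul_eq_one (-ii) (by linear_combination -ii_sq)

theorem tt_sq : tt ^ 2 = 2 * ii := by
  rw [tt]; linear_combination ii_sq

theorem GaussianInt.congr_of_tt_pow_seven_dvd {π : GaussianInt} (h : tt ^ 7 ∣ π - 1) :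
    π.re % 8 = 1 ∧ π.im % 8 = 0 := by
  obtain ⟨c, hc⟩ := h
  have h7 : tt ^ 7 = ⟨8, -8⟩ := by
    rw [show tt ^ 7 = (tt ^ 2) ^ 3 * tt by ring, tt_sq,
      show (2 * ii) ^ 3 * tt = ii ^ 2 * (8 * ii * tt) by ring,
      ii_sq]
    ext <;> simp [ii, tt]
  rw [h7] at hc
  have hr := congrArg Zsqrtd.re hc
  have hi := congrArg Zsqrtd.im hc
  simp at hr hi
  omega

theorem GaussianInt.norm_natAbs_mod_sixteen {π : GaussianInt} (hre : π.re % 8 = 1)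
    (him : π.im % 8 = 0) :
    π.norm.natAbs % 16 = 1 := by
  obtain ⟨x, hx⟩ : ∃ x, π.re = 8 * x + 1 := ⟨π.re / 8, by omega⟩
  obtain ⟨y, hy⟩ : ∃ y, π.im = 8 * y := ⟨π.im / 8, by omega⟩
  have : π.norm = 16 * (4 * x ^ 2 + x + 4 * y ^ 2) + 1 := by
    rw [Zsqrtd.norm_def, hx, hy]; ring
  have := GaussianInt.norm_nonneg π
  omega

theorem GaussianInt.isSquare_mk_ii {π : GaussianInt} (hπ : Prime π) (hre : π.re % 8 = 1)
    (him : π.im % 8 = 0) :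
    IsSquare (Ideal.Quotient.mk (Ideal.span {π}) ii) := by
  have hN := GaussianInt.norm_natAbs_mod_sixteen hre him
  rw [GaussianInt.isSquare_mk_span_iff hπ (by omega) fun h =>
    hπ.not_isUnit (isUnit_of_dvd_unit h isUnit_ii)]
  obtain ⟨k, hk⟩ : ∃ k, π.norm.natAbs / 2 = 2 * (2 * k) := ⟨π.norm.natAbs / 2 / 4, by omega⟩
  rw [hk, pow_mul, ii_sq, pow_mul, neg_one_sq, one_pow, map_one]

theorem GaussianInt.not_dvd_tt {π : GaussianInt} (hπ : Prime π) (hre : π.re % 8 = 1)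
    (him : π.im % 8 = 0) :
    ¬ π ∣ tt := by
  rintro ⟨c, hc⟩
  have hN := GaussianInt.norm_natAbs_mod_sixteen hre him
  have h2 : (tt.norm).natAbs = π.norm.natAbs * c.norm.natAbs := by
    rw [hc, Zsqrtd.norm_mul, Int.natAbs_mul]
  have h3 : tt.norm.natAbs = 2 := by simp [tt, ii, Zsqrtd.norm_def]
  rw [h3] at h2
  have := Nat.le_of_dvd two_pos (Dvd.intro _ h2.symm)
  exact hπ.not_isUnit (Zsqrtd.norm_eq_one_iff.1 (by omega))

theorem GaussianInt.not_dvd_ii_pow_mul_tt_pow {π : GaussianInt} (hπ : Prime π)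
    (hre : π.re % 8 = 1) (him : π.im % 8 = 0) (m n : ℕ) : ¬ π ∣ ii ^ m * tt ^ n := fun h =>
  (hπ.dvd_mul.1 h).elim (fun h => hπ.not_isUnit (isUnit_of_dvd_unit h (isUnit_ii.pow m)))
    (fun h => GaussianInt.not_dvd_tt hπ hre him (hπ.dvd_of_dvd_pow h))

theorem GaussianInt.natPrime_of_prime_natCast {p : ℕ} (h : Prime (p : GaussianInt)) :
    p.Prime := by
  have hunit : ∀ a : ℕ, IsUnit (a : GaussianInt) → IsUnit a := by
    intro a ha
    have := Zsqrtd.norm_eq_one_iff.2 ha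
    rw [Zsqrtd.norm_natCast, Int.natAbs_mul, Int.natAbs_natCast] at this
    exact .of_mul_eq_one _ this
  rw [Nat.prime_iff, ← irreducible_iff_prime]
  refine ⟨fun hu => h.not_isUnit (hu.map (Nat.castRingHom GaussianInt)), fun a b hab => ?_⟩
  have : (p : GaussianInt) = a * b := by rw [hab, Nat.cast_mul]
  exact (h.irreducible.isUnit_or_isUnit this).imp (hunit a) (hunit b)

theorem GaussianInt.isSquare_mk_tt {π : GaussianInt} (hπ : Prime π) (hre : π.re % 8 = 1)
    (him : π.im % 8 = 0) :
    IsSquare (Ideal.Quotient.mk (Ideal.span {π}) tt) := by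
  have hmax : (Ideal.span {π}).IsMaximal :=
    PrincipalIdealRing.isMaximal_of_irreducible hπ.irreducible
  let : Field (GaussianInt ⧸ Ideal.span {π}) := Ideal.Quotient.field _
  have hN := GaussianInt.norm_natAbs_mod_sixteen hre him
  set mk := Ideal.Quotient.mk (Ideal.span {π})
  have hi2 : mk ii ^ 2 = -1 := by rw [← map_pow, ii_sq, map_neg, map_one]
  by_cases him0 : π.im = 0
  · have hcast : π = (π.re : GaussianInt) := by ext <;> simp [him0]
    set p := π.re.natAbs with hpdef
    have hassoc : (p : GaussianInt) = π ∨ (p : GaussianInt) = -π := by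
      rcases Int.natAbs_eq π.re with h | h
      · left; rw [hcast, h]; simp [hpdef]
      · right; rw [hcast, h]; simp [hpdef]
    have hpG : Prime (p : GaussianInt) := by
      rcases hassoc with h | h <;> rw [h]
      exacts [hπ, hπ.neg]
    have hp : p.Prime := GaussianInt.natPrime_of_prime_natCast hpG
    have : Fact p.Prime := ⟨hp⟩
    have hp4 := (GaussianInt.prime_iff_mod_four_eq_three_of_nat_prime p).1 hpG
    have hp8 : p % 8 = 7 := by omega
    have hp0 : ((p : ℕ) : GaussianInt ⧸ Ideal.span {π}) = 0 := by
      rw [← map_natCast mk, Ideal.Quotient.eq_zero_iff_mem, Ideal.mem_span_singleton]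
      rcases hassoc with h | h <;> simp [h]
    have : CharP (GaussianInt ⧸ Ideal.span {π}) p := (CharP.charP_iff_prime_eq_zero hp).2 hp0
    rw [GaussianInt.isSquare_mk_span_iff hπ (by omega) (GaussianInt.not_dvd_tt hπ hre him)]
    have hnorm : π.norm.natAbs / 2 = (p + 1) * (p / 2) := by
      have : π.norm.natAbs = p * p := by
        rw [Zsqrtd.norm_def, him0, mul_zero, sub_zero, Int.natAbs_mul]
      rw [this]
      obtain ⟨k, hk⟩ : ∃ k, p = 2 * k + 1 := ⟨p / 2, by omega⟩
      rw [hk, show (2 * k + 1) / 2 = k by omega,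
        show (2 * k + 1) * (2 * k + 1) = 2 * ((2 * k + 1 + 1) * k) + 1 by ring]
      omega
    have h2 : (2 : GaussianInt ⧸ Ideal.span {π}) ^ (p / 2) = 1 := by
      have h0 : (2 : ZMod p) ≠ 0 := by
        intro h
        have := (ZMod.natCast_eq_zero_iff 2 p).1 (by exact_mod_cast h)
        have := Nat.le_of_dvd two_pos this
        omega
      have := (ZMod.euler_criterion p h0).1
        ((ZMod.exists_sq_eq_two_iff (by omega)).2 (Or.inr hp8))
      have := congrArg (ZMod.castHom dvd_rfl (GaussianInt ⧸ Ideal.span {π})) this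
      rwa [map_pow, map_ofNat, map_one] at this
    have hfrob : mk tt ^ (p + 1) = 2 := by
      have hip : mk ii ^ p = - mk ii := by
        obtain ⟨k, hk⟩ : ∃ k, p = 2 * (2 * k + 1) + 1 := ⟨p / 4, by omega⟩
        rw [hk, pow_succ, pow_mul, hi2, Odd.neg_one_pow ⟨k, rfl⟩, neg_one_mul]
      rw [pow_succ, tt, map_add, map_one, add_pow_char, one_pow, hip]
      linear_combination -hi2
    rw [hnorm, map_pow, pow_mul, hfrob, h2]
  · obtain ⟨p, hp, hnorm⟩ := GaussianInt.exists_prime_norm_eq hπ (by omega) him0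
    have : Fact p.Prime := ⟨hp⟩
    have hp0 : ((p : ℕ) : GaussianInt ⧸ Ideal.span {π}) = 0 := by
      rw [← map_natCast mk, Ideal.Quotient.eq_zero_iff_mem, Ideal.mem_span_singleton,
        ← Int.cast_natCast, ← hnorm, Zsqrtd.norm_eq_mul_conj]
      exact dvd_mul_right _ _
    have : CharP (GaussianInt ⧸ Ideal.span {π}) p := (CharP.charP_iff_prime_eq_zero hp).2 hp0
    have hsum : (p : ℤ) = π.re ^ 2 + π.im ^ 2 := by rw [← hnorm, Zsqrtd.norm_def]; ring
    have hsq := (isSquare_mul_sub_of_prime_sq_add_sq hsum hre him him0).map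
      (ZMod.castHom dvd_rfl (GaussianInt ⧸ Ideal.span {π}))
    rw [map_intCast] at hsq
    have hb0 : ((π.im : ℤ) : GaussianInt ⧸ Ideal.span {π}) ≠ 0 := by
      rw [Ne, CharP.intCast_eq_zero_iff _ p]
      rintro ⟨k, hk⟩
      have hk0 : k ≠ 0 := by rintro rfl; exact him0 (by simpa using hk)
      have hk1 : 1 ≤ k ^ 2 := by have := sq_pos_of_ne_zero hk0; omega
      have hp2 : (2 : ℤ) ≤ p := by exact_mod_cast hp.two_le
      rw [hk] at hsum
      nlinarith [sq_nonneg π.re, mul_le_mul_of_nonneg_left hk1 (sq_nonneg (p : ℤ))]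
    have hrel : (π.re : GaussianInt ⧸ Ideal.span {π}) + π.im * mk ii = 0 := by
      rw [← map_intCast mk, ← map_intCast mk, ← map_mul, ← map_add,
        Ideal.Quotient.eq_zero_iff_mem, Ideal.mem_span_singleton]
      apply dvd_of_eq
      ext <;> simp [ii]
    obtain ⟨r, hr⟩ := hsq
    refine ⟨r / π.im, ?_⟩
    rw [tt, map_add, map_one]
    push_cast at hr
    field_simp
    linear_combination hr + π.im * hrel

theorem GaussianInt.isSquare_mk_prod_iff {π : GaussianInt} (hπ : Prime π) (hre : π.re % 8 = 1)
    (him : π.im % 8 = 0) {ι : Type*} (T : Finset ι) (f : ι → GaussianInt) (e : ι → ZMod 4)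
    (h : ∀ k ∈ T, π ∣ f k ^ ((π.norm.natAbs - 1) / 4) - ii ^ (e k).val) :
    ¬ π ∣ ∏ k ∈ T, f k ∧
      (IsSquare (Ideal.Quotient.mk (Ideal.span {π}) (∏ k ∈ T, f k)) ↔ ∑ k ∈ T, c2 (e k) = 0) := by
  have hN := GaussianInt.norm_natAbs_mod_sixteen hre him
  have hN1 : π.norm.natAbs ≠ 1 := fun h => hπ.not_isUnit (Zsqrtd.norm_eq_one_iff.1 h)
  have hdvd : ¬ π ∣ ∏ k ∈ T, f k := by
    rw [hπ.dvd_finsetProd_iff]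
    rintro ⟨k, hk, hdvd⟩
    have := (dvd_sub_right (hdvd.trans (dvd_pow_self _ (by omega)))).1 (h k hk)
    exact hπ.not_isUnit (isUnit_of_dvd_unit this (isUnit_ii.pow _))
  refine ⟨hdvd, ?_⟩
  rw [GaussianInt.isSquare_mk_span_iff hπ (by omega) hdvd]
  have hpow : Ideal.Quotient.mk (Ideal.span {π}) ((∏ k ∈ T, f k) ^ (π.norm.natAbs / 2)) =
      (-1) ^ ∑ k ∈ T, (e k).val := by
    rw [← Finset.prod_pow_eq_pow_sum, ← Finset.prod_pow, map_prod]
    refine Finset.prod_congr rfl fun k hk => ?_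
    have hk' := Ideal.Quotient.eq.2 (Ideal.mem_span_singleton.2 (h k hk))
    rw [show π.norm.natAbs / 2 = (π.norm.natAbs - 1) / 4 * 2 by omega, pow_mul, map_pow, hk',
      ← map_pow, ← pow_mul, mul_comm, pow_mul, ii_sq, map_pow, map_neg, map_one]
  have hne : (-1 : GaussianInt ⧸ Ideal.span {π}) ≠ 1 := by
    intro h1
    rw [← map_one (Ideal.Quotient.mk (Ideal.span {π})), ← map_neg, Ideal.Quotient.eq,
      Ideal.mem_span_singleton] at h1
    have h2 : π ∣ tt ^ 4 := h1.trans
      ⟨2, by linear_combination (tt ^ 2 + 2 * ii) * tt_sq + 4 * ii_sq⟩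
    exact GaussianInt.not_dvd_tt hπ hre him (hπ.dvd_of_dvd_pow h2)
  have hc2 : ∀ x : ZMod 4, c2 x = (x.val : ZMod 2) := fun x => by
    rw [← map_natCast c2, ZMod.natCast_zmod_val]
  simp_rw [hpow, hc2, ← Nat.cast_sum]
  rw [neg_one_pow_eq_one_iff_even hne, ZMod.natCast_eq_zero_iff_even]

theorem hasLocalPoint_iff_of_forall {π b d : GaussianInt} (hπ : Prime π) {A : Prop}
    (h : ∀ v : HeightOneSpectrum GaussianInt, v.asIdeal = Ideal.span {π} →
      (((∃ z w : v.adicCompletion (FractionRing GaussianInt),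
        algebraMap GaussianInt _ d * w ^ 2
          = (algebraMap GaussianInt _ d) ^ 2 - 4 * algebraMap GaussianInt _ b * z ^ 4)
      ∨ (∃ u : v.adicCompletion (FractionRing GaussianInt),
        u ^ 2 * algebraMap GaussianInt _ d = algebraMap GaussianInt _ b)) ↔ A)) :
    HasLocalPoint b d π ↔ A := by
  have hprime := (Ideal.span_singleton_prime hπ.ne_zero).2 hπ
  have hbot : Ideal.span {π} ≠ ⊥ := by rw [Ne, Ideal.span_singleton_eq_bot]; exact hπ.ne_zero
  exact ⟨fun hloc => (h ⟨_, hprime, hbot⟩ rfl).1 (hloc _ rfl), fun hA v hv => (h v hv).2 hA⟩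

theorem GaussianInt.valued_two_eq_one {π : GaussianInt} (hπ : Prime π) (hre : π.re % 8 = 1)
    (him : π.im % 8 = 0) {v : HeightOneSpectrum GaussianInt} (hv : v.asIdeal = Ideal.span {π}) :
    Valued.v (2 : v.adicCompletion (FractionRing GaussianInt)) = 1 := by
  rw [← map_ofNat (algebraMap GaussianInt (v.adicCompletion (FractionRing GaussianInt))) 2,
    v.valued_algebraMap_eq_one_iff (FractionRing GaussianInt), hv, Ideal.mem_span_singleton]
  intro h
  exact GaussianInt.not_dvd_tt hπ hre him
    (hπ.dvd_of_dvd_pow (h.trans (Dvd.intro _ tt_sq.symm)))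

theorem GaussianInt.isSquare_of_valued_sub_one_lt {π : GaussianInt} (hπ : Prime π)
    (hre : π.re % 8 = 1) (him : π.im % 8 = 0) {v : HeightOneSpectrum GaussianInt}
    (hv : v.asIdeal = Ideal.span {π}) (x : v.adicCompletion (FractionRing GaussianInt))
    (hx : Valued.v (x - 1) < 1) : IsSquare x :=
  Valued.isSquare_of_v_sub_one_lt (GaussianInt.valued_two_eq_one hπ hre him hv) hx

theorem GaussianInt.isSquare_algebraMap_iff {π : GaussianInt} (hπ : Prime π) (hre : π.re % 8 = 1)
    (him : π.im % 8 = 0) {v : HeightOneSpectrum GaussianInt} (hv : v.asIdeal = Ideal.span {π})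
    {x : GaussianInt} (hx : ¬ π ∣ x) :
    IsSquare (algebraMap GaussianInt (v.adicCompletion (FractionRing GaussianInt)) x) ↔
      IsSquare (Ideal.Quotient.mk (Ideal.span {π}) x) := by
  have := v.isSquare_algebraMap_adicCompletion_iff (FractionRing GaussianInt)
    (GaussianInt.isSquare_of_valued_sub_one_lt hπ hre him hv)
    (x := x) (by rwa [hv, Ideal.mem_span_singleton])
  rw [this, ← hv]

theorem GaussianInt.isSquare_algebraMap_ii_tt {π : GaussianInt} (hπ : Prime π)
    (hre : π.re % 8 = 1) (him : π.im % 8 = 0) {v : HeightOneSpectrum GaussianInt}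
    (hv : v.asIdeal = Ideal.span {π}) (m n : ℕ) :
    IsSquare (algebraMap GaussianInt (v.adicCompletion (FractionRing GaussianInt))
      (ii ^ m * tt ^ n)) := by
  rw [map_mul, map_pow, map_pow]
  refine (IsSquare.pow m ?_).mul (IsSquare.pow n ?_)
  · exact (GaussianInt.isSquare_algebraMap_iff hπ hre him hv
      fun h => hπ.not_isUnit (isUnit_of_dvd_unit h isUnit_ii)).2
        (GaussianInt.isSquare_mk_ii hπ hre him)
  · exact (GaussianInt.isSquare_algebraMap_iff hπ hre him hv
      (GaussianInt.not_dvd_tt hπ hre him)).2 (GaussianInt.isSquare_mk_tt hπ hre him)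

theorem GaussianInt.not_isSquare_valued {π : GaussianInt} (hπ : Prime π)
    {v : HeightOneSpectrum GaussianInt} (hv : v.asIdeal = Ideal.span {π}) {m : GaussianInt}
    (hm : ¬ π ∣ m) :
    ¬ IsSquare (Valued.v
      (algebraMap GaussianInt (v.adicCompletion (FractionRing GaussianInt)) (π * m))) := by
  have hm1 := (v.valued_algebraMap_eq_one_iff (FractionRing GaussianInt) m).2
    (by rwa [hv, Ideal.mem_span_singleton])
  have hπ1 : Valued.v
      (algebraMap GaussianInt (v.adicCompletion (FractionRing GaussianInt)) π) =
        WithZero.exp (-1 : ℤ) :=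
    (HeightOneSpectrum.valuedAdicCompletion_eq_valuation
      (K := FractionRing GaussianInt) v π).trans <| by
      rw [HeightOneSpectrum.valuation_of_algebraMap]
      exact v.intValuation_singleton hπ.ne_zero hv
  rw [map_mul, map_mul, hm1, mul_one, hπ1]
  rintro ⟨r, hr⟩
  have hr0 : r ≠ 0 := by rintro rfl; simp at hr
  have := congrArg WithZero.log hr
  rw [WithZero.log_mul hr0 hr0, WithZero.log_exp] at this
  omega

theorem hasLocalPoint_iff_of_not_dvd {π : GaussianInt} (hπ : Prime π) (hre : π.re % 8 = 1)
    (him : π.im % 8 = 0) {s t m n : ℕ} {P Q b d : GaussianInt} (hP : ¬ π ∣ P) (hQ : ¬ π ∣ Q)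
    (hb : b = (-1) ^ s * tt ^ (2 * t) * (P * (π * Q)) ^ 2) (hd : d = ii ^ m * tt ^ n * P) :
    HasLocalPoint b d π ↔ IsSquare (Ideal.Quotient.mk (Ideal.span {π}) P) := by
  have hut := GaussianInt.not_dvd_ii_pow_mul_tt_pow hπ hre him
  refine hasLocalPoint_iff_of_forall hπ fun v hv => ?_
  let φ := algebraMap GaussianInt (v.adicCompletion (FractionRing GaussianInt))
  have hneg : IsSquare (-1 : v.adicCompletion (FractionRing GaussianInt)) :=
    ⟨φ ii, by rw [← sq, ← map_pow, ii_sq, map_neg, map_one]⟩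
  have hunit : ∀ x, ¬ π ∣ x → Valued.v (φ x) = 1 := fun x hx =>
    (v.valued_algebraMap_eq_one_iff (FractionRing GaussianInt) x).2
      (by rwa [hv, Ideal.mem_span_singleton])
  have hne : ∀ x, ¬ π ∣ x → φ x ≠ 0 := fun x hx h => by
    have := hunit x hx
    simp [h] at this
  rw [localPoint_iff_of_valuation_eq_one (V := Valued.v) (β := φ (π * (ii ^ s * tt ^ t * (P * Q))))
    (GaussianInt.isSquare_of_valued_sub_one_lt hπ hre him hv) hneg
    (GaussianInt.valued_two_eq_one hπ hre him hv) ?_ ?_ ?_, hd, mul_comm _ P, map_mul,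
    isSquare_mul_right_iff (hne _ (hut m n))
      (GaussianInt.isSquare_algebraMap_ii_tt hπ hre him hv m n),
    GaussianInt.isSquare_algebraMap_iff hπ hre him hv hP]
  · rw [← map_pow, hb, ← ii_sq]
    congr 1
    ring
  · exact GaussianInt.not_isSquare_valued hπ hv (hπ.not_dvd_mul (hut s t) (hπ.not_dvd_mul hP hQ))
  · rw [hd]
    exact hunit _ (hπ.not_dvd_mul (hut m n) hP)

theorem hasLocalPoint_iff_of_dvd {π : GaussianInt} (hπ : Prime π) (hre : π.re % 8 = 1)
    (him : π.im % 8 = 0) {s t m n : ℕ} {P Q b d : GaussianInt} (hP : ¬ π ∣ P) (hQ : ¬ π ∣ Q)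
    (hb : b = (-1) ^ s * tt ^ (2 * t) * (π * P * Q) ^ 2) (hd : d = ii ^ m * tt ^ n * (π * P)) :
    HasLocalPoint b d π ↔ IsSquare (Ideal.Quotient.mk (Ideal.span {π}) Q) := by
  have hut := GaussianInt.not_dvd_ii_pow_mul_tt_pow hπ hre him
  refine hasLocalPoint_iff_of_forall hπ fun v hv => ?_
  let φ := algebraMap GaussianInt (v.adicCompletion (FractionRing GaussianInt))
  have hneg : IsSquare (-1 : v.adicCompletion (FractionRing GaussianInt)) :=
    ⟨φ ii, by rw [← sq, ← map_pow, ii_sq, map_neg, map_one]⟩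
  have hunit : ∀ x, ¬ π ∣ x → Valued.v (φ x) = 1 := fun x hx =>
    (v.valued_algebraMap_eq_one_iff (FractionRing GaussianInt) x).2
      (by rwa [hv, Ideal.mem_span_singleton])
  have hne : ∀ x, ¬ π ∣ x → φ x ≠ 0 := fun x hx h => by
    have := hunit x hx
    simp [h] at this
  have hβ := GaussianInt.not_isSquare_valued hπ hv
    (hπ.not_dvd_mul (hut s t) (hπ.not_dvd_mul hP hQ))
  have hπ0 : φ π ≠ 0 := fun h => hβ ⟨0, by rw [map_mul, show algebraMap _ _ π = _ from h]; simp⟩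
  have hfactor : 2 * φ (π * (ii ^ s * tt ^ t * (P * Q))) * φ d =
      φ Q * (φ (ii ^ (s + m + 3) * tt ^ (t + n + 2)) * φ (π * P) ^ 2) := by
    rw [hd, ← map_ofNat φ 2, ← map_mul, ← map_mul, ← map_pow, ← map_mul, ← map_mul]
    congr 1
    have h2 : (2 : GaussianInt) = ii ^ 3 * tt ^ 2 := by
      linear_combination 2 * (1 - ii ^ 2) * ii_sq - ii ^ 3 * tt_sq
    rw [h2]
    ring
  rw [localPoint_iff_of_valuation_eq (V := Valued.v) (β := φ (π * (ii ^ s * tt ^ t * (P * Q))))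
    (GaussianInt.isSquare_of_valued_sub_one_lt hπ hre him hv) hneg
    (GaussianInt.valued_two_eq_one hπ hre him hv) ?_ hβ ?_]
  · erw [hfactor]
    rw [isSquare_mul_right_iff, GaussianInt.isSquare_algebraMap_iff hπ hre him hv hQ]
    · exact mul_ne_zero (hne _ (hut _ _))
        (pow_ne_zero 2 (by rw [map_mul]; exact mul_ne_zero hπ0 (hne _ hP)))
    · exact (GaussianInt.isSquare_algebraMap_ii_tt hπ hre him hv _ _).mul (IsSquare.sq _)
  · rw [← map_pow, hb, ← ii_sq]
    congr 1
    ring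
  · rw [hd, mul_left_comm, map_mul, map_mul, map_mul φ π, map_mul _ (φ π)]
    erw [hunit _ (hπ.not_dvd_mul (hut m n) hP),
      hunit _ (hπ.not_dvd_mul (hut s t) (hπ.not_dvd_mul hP hQ))]

theorem mulVec_map_LapQ {N : ℕ} (E : Fin N → Fin N → ZMod 4)
    (S : Finset (Fin N)) (j : Fin N) :
    ((LapQ E).map c2).mulVec (fun j => if j ∈ S then 1 else 0) j =
      if j ∈ S then ∑ k ∈ Sᶜ, c2 (E j k) else -∑ k ∈ S, c2 (E j k) := by
  have h : ((LapQ E).map c2).mulVec (fun j => if j ∈ S then 1 else 0) j =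
      (if j ∈ S then ∑ k, c2 (E j k) else 0) - ∑ k ∈ S, c2 (E j k) := by
    simp [Matrix.mulVec, dotProduct, LapQ, Finset.sum_sub_distrib, apply_ite c2, Finset.sum_ite_eq]
  rw [h, ← Finset.sum_compl_add_sum S]
  split_ifs <;> ring

/-- **Statement 18.**  Suppose `b = (−1)^s (1+i)^{2t} q₁²⋯q_N²` with the `q_j` distinct
primary primes congruent to `1` mod `(1+i)⁷`, and let
`d = i^{s_d}(1+i)^{t_d} ∏_{j ∈ S} q_j` be a square-free divisor of `b`, with indicator
vector `𝟙^{(d)} ∈ 𝔽₂^N`.  Then `C_d(ℚ(i)_v) ≠ ∅` for every odd prime `v ∣ b` iff the mod-2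
reduction of the Laplacian satisfies `L(G_b) · 𝟙^{(d)} = 0` over `𝔽₂`. -/
theorem lsc_away_square_case_kernel
    (N : ℕ) (q : Fin N → GaussianInt) (s t : ℕ) (hs : s ≤ 1) (ht : t ≤ 1)
    (hprime : ∀ j, Prime (q j) ∧ IsPrimary (q j))
    (hq7 : ∀ j, tt ^ 7 ∣ (q j - 1))
    (hdist : Function.Injective q)
    (b : GaussianInt)
    (hb : b = (-1) ^ s * tt ^ (2 * t) * ∏ j, q j ^ 2)
    (E : Fin N → Fin N → ZMod 4)
    (hE : ∀ v w, v ≠ w → q v ∣ (q w ^ (((q v).norm.natAbs - 1) / 4) - ii ^ (E v w).val))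
    (hE0 : ∀ v, E v v = 0)
    (sd td : ℕ) (hsd : sd ≤ 1) (htd : td ≤ 1)
    (S : Finset (Fin N)) (d : GaussianInt)
    (hd : d = ii ^ sd * tt ^ td * ∏ j ∈ S, q j) :
    (∀ j : Fin N, HasLocalPoint b d (q j)) ↔
      ((LapQ E).map c2).mulVec (fun j => if j ∈ S then 1 else 0) = 0 := by
  rw [funext_iff]
  refine forall_congr' fun j => ?_
  obtain ⟨hre, him⟩ := GaussianInt.congr_of_tt_pow_seven_dvd (hq7 j)
  have hπ := (hprime j).1
  have key := fun (T : Finset (Fin N)) (hT : j ∉ T) =>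
    GaussianInt.isSquare_mk_prod_iff hπ hre him T q (E j) fun k hk =>
      hE j k fun h => hT (h ▸ hk)
  rw [mulVec_map_LapQ, Pi.zero_apply]
  rw [Finset.prod_pow] at hb
  split_ifs with hj
  · obtain ⟨hQ, hiff⟩ := key Sᶜ (by simpa using hj)
    rw [← hiff]
    refine hasLocalPoint_iff_of_dvd (s := s) (t := t) (m := sd) (n := td) hπ hre him
      (key (S.erase j) (S.notMem_erase j)).1 hQ ?_ ?_
    · rw [Finset.mul_prod_erase S q hj, Finset.prod_mul_prod_compl, hb]
    · rw [Finset.mul_prod_erase S q hj, hd]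
  · obtain ⟨hP, hiff⟩ := key S hj
    rw [neg_eq_zero, ← hiff]
    refine hasLocalPoint_iff_of_not_dvd (s := s) (t := t) hπ hre him hP
      (key (Sᶜ.erase j) (Sᶜ.notMem_erase j)).1 ?_ hd
    rw [Finset.mul_prod_erase Sᶜ q (by simpa using hj), Finset.prod_mul_prod_compl, hb]
end
end
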